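/- Let p be an odd prime and r = p^m with r = 2h + 1 (so h = (r-1)/2). If h is even, then the cyclotomic numbers of order 2 over F_r satisfy (0,0) = (h-2)/2 and (0,1) = (1,0) = (1,1) = h/2, where (i,j) denotes the number of ordered pairs (s,t) with 0 ≤ s,t ≤ h-1 such that α^{2s+i} + 1 = α^{2t+j} for a fixed primitive element α of F_r. -/

import Mathlib

/-- The number of `x` such that `x` has quadratic character `a` and `x + 1` has quadratic
character `b`. -/
def quadraticPairCount (F : Type) [Field F] [Fintype F] [DecidableEq F] (a b : ℤ) : ℕ :=
  (Finset.univ.filter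
    (fun x : F => quadraticChar F x = a ∧ quadraticChar F (x + 1) = b)).card

section

variable {F : Type} [Field F] [Fintype F] [DecidableEq F]

theorem quadraticChar_primitive {h : ℕ} (hF : ringChar F ≠ 2)
    (hcard : Fintype.card F = 2 * h + 1) (hpos : 0 < h) {α : F} (hα : orderOf α = 2 * h) :
    quadraticChar F α = -1 := by
  have h0 : α ≠ 0 := by
    rintro rfl
    rw [orderOf_zero] at hα
    omega
  rw [quadraticChar_neg_one_iff_not_isSquare]
  intro hsq
  rw [FiniteField.isSquare_iff hF h0, hcard] at hsq
  have := orderOf_dvd_of_pow_eq_one hsq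
  rw [hα] at this
  have := Nat.le_of_dvd (by omega) this
  omega

theorem exists_pow_eq_of_orderOf_eq {h : ℕ} (hcard : Fintype.card F = 2 * h + 1) (hpos : 0 < h)
    {α : F} (hα : orderOf α = 2 * h) {x : F} (hx : x ≠ 0) : ∃ k < 2 * h, α ^ k = x := by
  have himage : (Finset.range (2 * h)).image (fun k => α ^ k) = Finset.univ.erase (0 : F) := by
    apply Finset.eq_of_subset_of_card_le
    · intro y hy
      obtain ⟨k, -, rfl⟩ := Finset.mem_image.1 hy
      have h0 : α ≠ 0 := by
        rintro rfl
        rw [orderOf_zero] at hα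
        omega
      simp [h0]
    · rw [Finset.card_erase_of_mem (Finset.mem_univ _), Finset.card_univ, hcard,
        Finset.card_image_of_injOn]
      · simp
      · intro a ha b hb hab
        apply pow_injOn_Iio_orderOf (x := α) _ _ hab <;> simp_all
  have hmem : x ∈ Finset.univ.erase (0 : F) := by simp [hx]
  rw [← himage] at hmem
  simpa using hmem

theorem exists_pow_eq_iff_quadraticChar_eq {h : ℕ} (hF : ringChar F ≠ 2)
    (hcard : Fintype.card F = 2 * h + 1) (hpos : 0 < h) {α : F} (hα : orderOf α = 2 * h)
    {i : ℕ} (hi : i < 2) (x : F) :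
    (∃ s < h, α ^ (2 * s + i) = x) ↔ quadraticChar F x = (-1) ^ i := by
  have hχ := quadraticChar_primitive hF hcard hpos hα
  constructor
  · rintro ⟨s, -, rfl⟩
    rw [map_pow, hχ, pow_add, pow_mul]
    simp
  · intro hx
    have h0 : x ≠ 0 := by
      rintro rfl
      rw [quadraticChar_zero] at hx
      exact pow_ne_zero i (by norm_num) hx.symm
    obtain ⟨k, hk, rfl⟩ := exists_pow_eq_of_orderOf_eq hcard hpos hα h0
    rw [map_pow, hχ] at hx
    have hki : k % 2 = i := by
      rcases Nat.even_or_odd k with he | ho <;> interval_cases i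
      · exact Nat.even_iff.1 he
      · rw [he.neg_one_pow] at hx; norm_num at hx
      · rw [ho.neg_one_pow] at hx; norm_num at hx
      · exact Nat.odd_iff.1 ho
    exact ⟨k / 2, by omega, by congr 1; omega⟩

omit [Fintype F] [DecidableEq F] in
theorem pow_two_mul_add_injOn {h : ℕ} {α : F} (hα : orderOf α = 2 * h) {i : ℕ} (hi : i < 2) :
    Set.InjOn (fun s => α ^ (2 * s + i)) (Finset.range h : Set ℕ) := by
  intro s hs t ht hst
  simp only [Finset.coe_range, Set.mem_Iio] at hs ht
  have := pow_injOn_Iio_orderOf (x := α) (x₁ := 2 * s + i) (x₂ := 2 * t + i)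
    (by rw [Set.mem_Iio, hα]; omega) (by rw [Set.mem_Iio, hα]; omega) hst
  omega

theorem card_quadraticChar_eq {h : ℕ} (hF : ringChar F ≠ 2)
    (hcard : Fintype.card F = 2 * h + 1) (hpos : 0 < h) {α : F} (hα : orderOf α = 2 * h)
    {i : ℕ} (hi : i < 2) :
    (Finset.univ.filter (fun x : F => quadraticChar F x = (-1) ^ i)).card = h := by
  have himage : Finset.univ.filter (fun x : F => quadraticChar F x = (-1) ^ i) =
      (Finset.range h).image (fun s => α ^ (2 * s + i)) := by
    ext x
    simp only [Finset.mem_filter, Finset.mem_univ, true_and, Finset.mem_image, Finset.mem_range,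
      exists_pow_eq_iff_quadraticChar_eq hF hcard hpos hα hi]
  rw [himage, Finset.card_image_of_injOn (pow_two_mul_add_injOn hα hi), Finset.card_range]

theorem card_cyclotomic_pairs {h : ℕ} (hF : ringChar F ≠ 2)
    (hcard : Fintype.card F = 2 * h + 1) (hpos : 0 < h) {α : F} (hα : orderOf α = 2 * h)
    {i j : ℕ} (hi : i < 2) (hj : j < 2) :
    ((Finset.range h ×ˢ Finset.range h).filter
      (fun st => α ^ (2 * st.1 + i) + 1 = α ^ (2 * st.2 + j))).card =
    quadraticPairCount F ((-1) ^ i) ((-1) ^ j) := by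
  refine Finset.card_bij (fun st _ => α ^ (2 * st.1 + i)) ?_ ?_ ?_
  · rintro ⟨s, t⟩ hst
    simp only [Finset.mem_filter, Finset.mem_product, Finset.mem_range] at hst
    simp only [Finset.mem_filter, Finset.mem_univ, true_and]
    rw [← exists_pow_eq_iff_quadraticChar_eq hF hcard hpos hα hi,
      ← exists_pow_eq_iff_quadraticChar_eq hF hcard hpos hα hj]
    exact ⟨⟨s, hst.1.1, rfl⟩, t, hst.1.2, hst.2.symm⟩
  · rintro ⟨s, t⟩ hst ⟨s', t'⟩ hst' heq
    simp only [Finset.mem_filter, Finset.mem_product, Finset.mem_range] at hst hst' heq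
    have hs : s = s' := pow_two_mul_add_injOn hα hi (by simp [hst.1.1]) (by simp [hst'.1.1]) heq
    have ht : t = t' := pow_two_mul_add_injOn hα hj (by simp [hst.1.2]) (by simp [hst'.1.2])
      (by simp only [← hst.2, ← hst'.2, heq])
    rw [hs, ht]
  · intro x hx
    simp only [Finset.mem_filter, Finset.mem_univ, true_and] at hx
    rw [← exists_pow_eq_iff_quadraticChar_eq hF hcard hpos hα hi,
      ← exists_pow_eq_iff_quadraticChar_eq hF hcard hpos hα hj] at hx
    obtain ⟨⟨s, hs, rfl⟩, t, ht, hst⟩ := hx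
    exact ⟨(s, t), by simp [hs, ht, hst], rfl⟩

theorem quadraticPairCount_row (a : ℤ) :
    quadraticPairCount F a 1 + quadraticPairCount F a (-1) +
      (if quadraticChar F (-1) = a then 1 else 0) =
    (Finset.univ.filter (fun x : F => quadraticChar F x = a)).card := by
  have hone : (if quadraticChar F (-1) = a then 1 else 0) =
      ∑ x : F, if x = -1 then (if quadraticChar F x = a then 1 else 0) else 0 := by
    simp
  rw [hone, quadraticPairCount, quadraticPairCount, Finset.card_filter, Finset.card_filter,
    Finset.card_filter, ← Finset.sum_add_distrib, ← Finset.sum_add_distrib]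
  refine Finset.sum_congr rfl fun x _ => ?_
  by_cases hx : x = -1
  · subst hx
    simp
  · have hx' : x + 1 ≠ 0 := fun h => hx (eq_neg_of_add_eq_zero_left h)
    rcases quadraticChar_dichotomy hx' with h | h <;> simp [h, hx]

/-- The symmetry `x ↦ -1 - x` of the equation `x + 1 = y`. -/
theorem quadraticPairCount_comm (hneg : quadraticChar F (-1) = 1) (a b : ℤ) :
    quadraticPairCount F a b = quadraticPairCount F b a := by
  have hχ (y : F) : quadraticChar F (-y) = quadraticChar F y := by
    rw [← neg_one_mul, map_mul, hneg, one_mul]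
  refine Finset.card_equiv (Equiv.subLeft (-1)) fun x => ?_
  have h₁ : (-1 : F) - x = -(x + 1) := by ring
  have h₂ : -(x + 1) + 1 = -x := by ring
  simp only [Finset.mem_filter, Finset.mem_univ, true_and, Equiv.subLeft_apply, h₁, h₂, hχ]
  exact and_comm

/-- The symmetry `x ↦ x⁻¹` of the equation `x + 1 = y`. -/
theorem quadraticPairCount_inv {a : ℤ} (ha : a = 1 ∨ a = -1) (b : ℤ) :
    quadraticPairCount F a b = quadraticPairCount F a (a * b) := by
  have hinv (y : F) : quadraticChar F y⁻¹ = quadraticChar F y := by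
    by_cases hy : y = 0
    · simp [hy]
    · have := map_mul (quadraticChar F) y y⁻¹
      rw [mul_inv_cancel₀ hy, map_one] at this
      rcases quadraticChar_dichotomy hy with h | h <;> rw [h] at this ⊢ <;>
        linarith
  refine Finset.card_equiv (Equiv.inv F) fun x => ?_
  simp only [Finset.mem_filter, Finset.mem_univ, true_and, Equiv.inv_apply, hinv]
  refine and_congr_right fun hx => ?_
  have h0 : x ≠ 0 := by
    rintro rfl
    rw [quadraticChar_zero] at hx
    omega
  have hx1 : x⁻¹ + 1 = x⁻¹ * (x + 1) := by field_simp; ring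
  rw [hx1, map_mul, hinv, hx]
  rcases ha with rfl | rfl <;> simp

end

/-- Cyclotomic numbers of order 2 over `F_r`, `r = p^m = 2h+1`, when `h` is even:
`(0,0) = (h-2)/2` and `(0,1) = (1,0) = (1,1) = h/2`. -/
theorem stmt0 (p m h : ℕ) (hp : p.Prime) (hodd : p ≠ 2) (hm : 0 < m)
    (F : Type) [Field F] [Fintype F] [DecidableEq F]
    (hcard : Fintype.card F = p ^ m) (hr : p ^ m = 2 * h + 1)
    (α : F) (hα : orderOf α = 2 * h)
    (cyc : ℕ → ℕ → ℕ)
    (hcyc : ∀ i j, cyc i j =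
      ((Finset.range h ×ˢ Finset.range h).filter
        (fun st => α ^ (2 * st.1 + i) + 1 = α ^ (2 * st.2 + j))).card)
    (hh : Even h) :
    cyc 0 0 = (h - 2) / 2 ∧ cyc 0 1 = h / 2 ∧ cyc 1 0 = h / 2 ∧ cyc 1 1 = h / 2 := by
  rw [hr] at hcard
  have hpos : 0 < h := by
    have := Fintype.one_lt_card (α := F)
    omega
  obtain ⟨k, hk⟩ := hh
  have hF : ringChar F ≠ 2 := by
    intro h2
    have := FiniteField.even_card_iff_char_two.1 h2
    omega
  have hneg : quadraticChar F (-1) = 1 := by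
    rw [quadraticChar_one_iff_isSquare (neg_ne_zero.2 one_ne_zero),
      FiniteField.isSquare_neg_one_iff]
    omega
  have hcyc' {i j : ℕ} (hi : i < 2) (hj : j < 2) :
      cyc i j = quadraticPairCount F ((-1) ^ i) ((-1) ^ j) :=
    (hcyc i j).trans (card_cyclotomic_pairs hF hcard hpos hα hi hj)
  have hcard₀ := card_quadraticChar_eq hF hcard hpos hα (i := 0) (by norm_num)
  have hcard₁ := card_quadraticChar_eq hF hcard hpos hα (i := 1) (by norm_num)
  rw [hcyc' (by norm_num) (by norm_num), hcyc' (by norm_num) (by norm_num),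
    hcyc' (by norm_num) (by norm_num), hcyc' (by norm_num) (by norm_num)]
  rw [← quadraticPairCount_row, hneg] at hcard₀ hcard₁
  have hcomm := quadraticPairCount_comm hneg 1 (-1)
  have hinv := quadraticPairCount_inv (F := F) (a := -1) (Or.inr rfl) 1
  norm_num at hcard₀ hcard₁ hinv ⊢
  omega
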